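/- If two distinct intervals I_i and I_j intersect and have the same KT-SLS level, L(i) = L(j), then neither interval is contained in the other: I_i ⊄ I_j and I_j ⊄ I_i (indeed I_i ⊈ I_j and I_j ⊈ I_i). -/

import Mathlib

/-- A sequence of levels indexed by a finite type avoids some natural number, so every `mex` set of
levels is nonempty. -/
theorem exists_forall_level_ne {ι : Type*} [Finite ι] (L : ι → ℕ) : ∃ m, ∀ k, L k ≠ m := by
  obtain ⟨m, hm⟩ := (Set.finite_range L).exists_notMem
  exact ⟨m, fun k hk => hm ⟨k, hk⟩⟩

/-- The values of a function at the endpoints of finitely many intervals that satisfy a further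
condition form a finite set. -/
theorem finite_values_at_endpoints {ι : Type*} [Finite ι] (l r : ι → ℝ) (P : ℝ → Prop)
    (Q : ι → Prop) (f : ℝ → ℕ) :
    {h : ℕ | ∃ t : ℝ, P t ∧ (∃ j, Q j ∧ (t = l j ∨ t = r j)) ∧ h = f t}.Finite := by
  refine (((Set.finite_range l).union (Set.finite_range r)).image f).subset ?_
  rintro h ⟨t, -, ⟨j, -, hj⟩, rfl⟩
  refine ⟨t, ?_, rfl⟩
  rcases hj with rfl | rfl
  · exact Or.inl ⟨j, rfl⟩
  · exact Or.inr ⟨j, rfl⟩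

/-- If two distinct intervals intersect and have the same KT-SLS
level, then neither is contained in the other. The KT-SLS level `L i` is
characterized by its defining recurrence (`mex` over earlier intervals
containing a point, maximized over endpoints contained in `I i`). -/
theorem slsLevel_eq_no_containment
    (n : ℕ) (l r : Fin n → ℝ) (hlr : ∀ j, l j ≤ r j)
    (L : Fin n → ℕ)
    (hL : ∀ i : Fin n,
      L i = sSup { h : ℕ | ∃ t : ℝ, t ∈ Set.Icc (l i) (r i) ∧
          (∃ j : Fin n, j ≤ i ∧ (t = l j ∨ t = r j)) ∧
          h = sInf { m : ℕ | ∀ j : Fin n, j < i → t ∈ Set.Icc (l j) (r j) → L j ≠ m } }) :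
    ∀ i j : Fin n, i ≠ j →
      (Set.Icc (l i) (r i) ∩ Set.Icc (l j) (r j)).Nonempty →
      L i = L j →
      ¬ Set.Icc (l i) (r i) ⊆ Set.Icc (l j) (r j) ∧
      ¬ Set.Icc (l j) (r j) ⊆ Set.Icc (l i) (r i) := by
  have mex_ne (i : Fin n) (t : ℝ) (k : Fin n) (hk : k < i) (ht : t ∈ Set.Icc (l k) (r k)) :
      L k ≠ sInf {m : ℕ | ∀ j : Fin n, j < i → t ∈ Set.Icc (l j) (r j) → L j ≠ m} := by
    have hne : {m : ℕ | ∀ j : Fin n, j < i → t ∈ Set.Icc (l j) (r j) → L j ≠ m}.Nonempty :=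
      (exists_forall_level_ne L).imp fun _ hm j _ _ => hm j
    exact Nat.sInf_mem hne k hk ht
  have attained (i : Fin n) : ∃ t : ℝ, t ∈ Set.Icc (l i) (r i) ∧
      (∃ j : Fin n, j ≤ i ∧ (t = l j ∨ t = r j)) ∧
      L i = sInf {m : ℕ | ∀ j : Fin n, j < i → t ∈ Set.Icc (l j) (r j) → L j ≠ m} := by
    have hmem := Nat.sSup_mem
      (s := {h : ℕ | ∃ t : ℝ, t ∈ Set.Icc (l i) (r i) ∧
        (∃ j : Fin n, j ≤ i ∧ (t = l j ∨ t = r j)) ∧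
        h = sInf {m : ℕ | ∀ j : Fin n, j < i → t ∈ Set.Icc (l j) (r j) → L j ≠ m}})
      ⟨_, l i, ⟨le_rfl, hlr i⟩, ⟨i, le_rfl, Or.inl rfl⟩, rfl⟩
      (finite_values_at_endpoints l r _ _ _).bddAbove
    rwa [← hL i] at hmem
  have le_level (i : Fin n) (t : ℝ) (ht : t ∈ Set.Icc (l i) (r i))
      (he : ∃ j : Fin n, j ≤ i ∧ (t = l j ∨ t = r j)) :
      sInf {m : ℕ | ∀ j : Fin n, j < i → t ∈ Set.Icc (l j) (r j) → L j ≠ m} ≤ L i := by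
    rw [hL i]
    exact le_csSup (finite_values_at_endpoints l r _ _ _).bddAbove ⟨t, ht, he, rfl⟩
  have later_not_subset (i j : Fin n) (hij : i < j) (h : L i = L j) :
      ¬ Set.Icc (l j) (r j) ⊆ Set.Icc (l i) (r i) := by
    intro hsub
    obtain ⟨t, ht, -, hLt⟩ := attained j
    exact mex_ne j t i hij (hsub ht) (h.trans hLt)
  have earlier_not_subset (i j : Fin n) (hij : i < j) (h : L i = L j) :
      ¬ Set.Icc (l i) (r i) ⊆ Set.Icc (l j) (r j) := by
    intro hsub
    obtain ⟨t, ht, ⟨k, hk, he⟩, hLt⟩ := attained i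
    have hle := le_level j t (hsub ht) ⟨k, hk.trans hij.le, he⟩
    have hne := mex_ne j t i hij ht
    have hge : L i ≤ sInf {m : ℕ | ∀ j' : Fin n, j' < j → t ∈ Set.Icc (l j') (r j') → L j' ≠ m} := by
      rw [hLt]
      refine Nat.sInf_le fun k hk htk => mex_ne j t k (hk.trans hij) htk
    omega
  intro i j hne _ h
  rcases lt_or_gt_of_ne hne with hij | hji
  · exact ⟨earlier_not_subset i j hij h, later_not_subset i j hij h⟩
  · exact ⟨later_not_subset j i hji h.symm, earlier_not_subset j i hji h.symm⟩
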